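/- arXiv:2209.03266 — 4 statements merged into one kernel-verified Lean document; each statement's English description precedes it below -/
import Mathlib

section
/- Let ζ = (1 + √(5 + 4√3))/2 and c = log₂ ζ ≈ 1.15501186367066470321. Then E(n) = Θ(n^c); that is, there exist constants C₁, C₂ > 0 such that C₁ n^c ≤ E(n) ≤ C₂ n^c for all integers n ≥ 1. -/
/-- The Thue–Morse morphism μ : 0 ↦ 01, 1 ↦ 10 (false = 0, true = 1),
extended to finite binary words. -/
def mu (w : List Bool) : List Bool := (w.map (fun b => [b, !b])).flatten

/-- The set S = {ε, 0, 1, 00, 11}. -/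
def S : Set (List Bool) := {[], [false], [true], [false, false], [true, true]}

/-- A finite word `u` is a prefix of the infinite word `w`. -/
def PrefixSeq {α : Type*} (u : List α) (w : ℕ → α) : Prop :=
  ∀ (j : ℕ) (h : j < u.length), u.get ⟨j, h⟩ = w j

/-- A finite word `u` is a factor of the infinite word `w`. -/
def IsFactorSeq (u : List Bool) (w : ℕ → Bool) : Prop :=
  ∃ i : ℕ, ∀ (j : ℕ) (h : j < u.length), u.get ⟨j, h⟩ = w (i + j)

/-- The finite word `u` has period `p` (with `1 ≤ p ≤ |u|`):
`u[i] = u[i+p]` for all `0 ≤ i < |u| - p`. -/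
def HasPeriod (u : List Bool) (p : ℕ) : Prop :=
  1 ≤ p ∧ p ≤ u.length ∧ ∀ i, i + p < u.length → u.getD i false = u.getD (i + p) false

/-- The least period of a finite word. -/
noncomputable def leastPeriod (u : List Bool) : ℕ := sInf {p | HasPeriod u p}

/-- The exponent of a nonempty finite word: its length divided by its least period. -/
noncomputable def exponent (u : List Bool) : ℚ := (u.length : ℚ) / (leastPeriod u : ℚ)

/-- A finite word avoids α-powers: no nonempty factor has exponent ≥ α. -/
def AvoidsPow (a : ℚ) (w : List Bool) : Prop :=
  ∀ u : List Bool, u ≠ [] → u <:+: w → exponent u < a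

/-- A finite word avoids α⁺-powers: no nonempty factor has exponent > α. -/
def AvoidsPowPlus (a : ℚ) (w : List Bool) : Prop :=
  ∀ u : List Bool, u ≠ [] → u <:+: w → exponent u ≤ a

/-- An infinite word avoids α-powers. -/
def AvoidsPowSeq (a : ℚ) (w : ℕ → Bool) : Prop :=
  ∀ u : List Bool, u ≠ [] → IsFactorSeq u w → exponent u < a

/-- An infinite word avoids α⁺-powers. -/
def AvoidsPowPlusSeq (a : ℚ) (w : ℕ → Bool) : Prop :=
  ∀ u : List Bool, u ≠ [] → IsFactorSeq u w → exponent u ≤ a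

/-- An overlap is a word of the form a x a x a, with a a single letter. -/
def IsOverlap (u : List Bool) : Prop :=
  ∃ (a : Bool) (x : List Bool), u = [a] ++ x ++ [a] ++ x ++ [a]

/-- Overlap-freeness for finite words. -/
def OverlapFree (w : List Bool) : Prop := ∀ u : List Bool, u <:+: w → ¬ IsOverlap u

/-- Overlap-freeness for infinite words. -/
def OverlapFreeSeq (w : ℕ → Bool) : Prop := ∀ u : List Bool, IsFactorSeq u w → ¬ IsOverlap u

/-- The Thue–Morse word t = 0110100110010110⋯ : t[n] = 1 iff the number of
ones in the binary expansion of n is odd. -/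
def thueMorse : ℕ → Bool := fun n => (Nat.digits 2 n).count 1 % 2 == 1

/-- The complement t̄ of the Thue–Morse word. -/
def tmbar : ℕ → Bool := fun n => ! thueMorse n

/-- The infinite word obtained by prepending the finite word `u` to `w`. -/
def appendSeq (u : List Bool) (w : ℕ → Bool) : ℕ → Bool :=
  fun n => if h : n < u.length then u.get ⟨n, h⟩ else w (n - u.length)

/-- Lexicographic order on infinite binary words (with 0 < 1). -/
def seqLE (v w : ℕ → Bool) : Prop :=
  v = w ∨ ∃ n : ℕ, (∀ i < n, v i = w i) ∧ v n = false ∧ w n = true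

/-- The word x₀ μ(x₁) μ²(x₂) ⋯ μ^{n-1}(x_{n-1}). -/
def restivoJoin (x : ℕ → List Bool) (n : ℕ) : List Bool :=
  ((List.range n).map (fun i => mu^[i] (x i))).flatten

/-- Finite Restivo words: x₀ μ(x₁) ⋯ μ^t(x_t) with all xᵢ ∈ S. -/
def IsRestivo (w : List Bool) : Prop :=
  ∃ (t : ℕ) (x : ℕ → List Bool), (∀ i ≤ t, x i ∈ S) ∧ w = restivoJoin x (t + 1)

/-- Infinite Restivo words: x₀ μ(x₁) μ²(x₂) ⋯ with all xᵢ ∈ S and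
infinitely many xᵢ nonempty. -/
def IsRestivoSeq (w : ℕ → Bool) : Prop :=
  ∃ x : ℕ → List Bool, (∀ i, x i ∈ S) ∧ (∀ N : ℕ, ∃ i ≥ N, x i ≠ []) ∧
    ∀ n : ℕ, PrefixSeq (restivoJoin x n) w

/-- E(n): the number of binary words x of length n for which there exists an
infinite binary word y such that x·y is overlap-free. -/
noncomputable def E (n : ℕ) : ℕ :=
  Nat.card {x : List Bool // x.length = n ∧ ∃ y : ℕ → Bool, OverlapFreeSeq (appendSeq x y)}

/-- ζ = (1 + √(5 + 4√3))/2. -/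
noncomputable def zeta : ℝ := (1 + Real.sqrt (5 + 4 * Real.sqrt 3)) / 2

namespace BinarySeq

/-- `w` has an overlap of period `p` starting at position `i`. -/
def HasOverlapAt (w : ℕ → Bool) (i p : ℕ) : Prop :=
  0 < p ∧ ∀ j ≤ p, w (i + j) = w (i + j + p)

theorem overlapFreeSeq_iff (w : ℕ → Bool) :
    OverlapFreeSeq w ↔ ∀ i p, ¬ HasOverlapAt w i p := by
  constructor
  · rintro h i p ⟨hp, hw⟩
    obtain ⟨q, rfl⟩ : ∃ q, p = q + 1 := ⟨p - 1, by omega⟩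
    refine h ((List.range (2 * q + 3)).map fun k => w (i + k)) ⟨i, by simp⟩
      ⟨w i, (List.range q).map fun k => w (i + 1 + k), ?_⟩
    apply List.ext_getElem
    · simp; omega
    · intro k h₁ h₂
      simp only [List.length_map, List.length_range] at h₁
      have h₀ := hw 0 (by omega)
      have h₃ := hw (q + 1) le_rfl
      have h₄ := hw (k - (q + 1))
      simp only [List.getElem_append, List.getElem_map, List.getElem_range, List.length_append,
        List.length_map, List.length_range, List.length_cons, List.length_nil]
      grind
  · rintro h u ⟨i, hu⟩ ⟨a, x, rfl⟩
    refine h i (x.length + 1) ⟨by omega, fun j hj => ?_⟩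
    have h₁ := hu j (by simp; omega)
    have h₂ := hu (j + (x.length + 1)) (by simp; omega)
    rw [add_assoc, ← h₁, ← h₂]
    simp only [List.get_eq_getElem, List.getElem_append]
    grind

/-- The Thue–Morse morphism on infinite words. -/
def morph (v : ℕ → Bool) : ℕ → Bool := fun n => v (n / 2) ^^ decide (n % 2 = 1)

/-- The image under the Thue–Morse morphism with its first letter deleted. -/
def morphTail (v : ℕ → Bool) : ℕ → Bool := fun n => morph v (n + 1)

/-- The image under the Thue–Morse morphism with its first letter complemented. -/
def morphFlip (v : ℕ → Bool) : ℕ → Bool := fun n => morph v n ^^ decide (n = 0)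

theorem morph_two_mul (v : ℕ → Bool) (k : ℕ) : morph v (2 * k) = v k := by
  simp [morph]

theorem morph_two_mul_add_one (v : ℕ → Bool) (k : ℕ) : morph v (2 * k + 1) = !v k := by
  have h₁ : (2 * k + 1) / 2 = k := by omega
  have h₂ : (2 * k + 1) % 2 = 1 := by omega
  simp [morph, h₁, h₂]

theorem morph_succ_ne {v : ℕ → Bool} {m : ℕ} (hm : m % 2 = 0) : morph v m ≠ morph v (m + 1) := by
  obtain ⟨k, rfl⟩ : ∃ k, m = 2 * k := ⟨m / 2, by omega⟩
  simp [morph_two_mul, morph_two_mul_add_one]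

theorem morphFlip_of_pos (v : ℕ → Bool) {n : ℕ} (hn : 0 < n) : morphFlip v n = morph v n := by
  simp [morphFlip, hn.ne']

theorem HasOverlapAt.even_of_morph {v : ℕ → Bool} {i p : ℕ} (h : HasOverlapAt (morph v) i p) :
    p % 2 = 0 := by
  by_contra hp
  have alt : ∀ j ≤ p, morph v (i + j) = (morph v i ^^ decide (j % 2 = 1)) := by
    intro j
    induction j with
    | zero => simp
    | succ j ih =>
      intro hj
      have ih := ih (by omega)
      have hne : morph v (i + j) ≠ morph v (i + (j + 1)) := by
        by_cases hm : (i + j) % 2 = 0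
        · exact morph_succ_ne hm
        · rw [h.2 j (by omega), h.2 (j + 1) hj]
          have := morph_succ_ne (v := v) (m := i + j + p) (by omega)
          rwa [show i + (j + 1) + p = i + j + p + 1 by omega]
      rcases Nat.mod_two_eq_zero_or_one j with hj2 | hj2
      · have h₁ : (j + 1) % 2 = 1 := by omega
        rw [ih, hj2] at hne
        simpa [h₁, Bool.eq_not] using hne.symm
      · have h₁ : (j + 1) % 2 = 0 := by omega
        rw [ih, hj2] at hne
        simpa [h₁] using hne.symm
  have h₀ := h.2 0 (by omega)
  have h₁ := alt p le_rfl
  simp_all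

theorem HasOverlapAt.of_morph {v : ℕ → Bool} {i p : ℕ} (h : HasOverlapAt (morph v) i p) :
    HasOverlapAt v (i / 2) (p / 2) := by
  have hp := h.even_of_morph
  obtain ⟨hpos, hw⟩ := h
  refine ⟨by omega, fun j hj => ?_⟩
  by_cases hi : i % 2 = 0
  · have := hw (2 * j) (by omega)
    rwa [show i + 2 * j = 2 * (i / 2 + j) by omega,
      show 2 * (i / 2 + j) + p = 2 * (i / 2 + j + p / 2) by omega,
      morph_two_mul, morph_two_mul] at this
  · by_cases hj0 : j = 0
    · subst hj0
      have := hw 0 (by omega)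
      rwa [show i + 0 = 2 * (i / 2 + 0) + 1 by omega,
        show 2 * (i / 2 + 0) + 1 + p = 2 * (i / 2 + 0 + p / 2) + 1 by omega,
        morph_two_mul_add_one, morph_two_mul_add_one, Bool.not_inj_iff] at this
    · have := hw (2 * j - 1) (by omega)
      rwa [show i + (2 * j - 1) = 2 * (i / 2 + j) by omega,
        show 2 * (i / 2 + j) + p = 2 * (i / 2 + j + p / 2) by omega,
        morph_two_mul, morph_two_mul] at this

theorem HasOverlapAt.morphTail {v : ℕ → Bool} {i p : ℕ} (h : HasOverlapAt v i p) :
    HasOverlapAt (morphTail v) (2 * i) (2 * p) := by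
  refine ⟨by have := h.1; omega, fun j hj => ?_⟩
  have := h.2 ((j + 1) / 2) (by omega)
  simp only [BinarySeq.morphTail, morph]
  rw [show (2 * i + j + 1) / 2 = i + (j + 1) / 2 by omega,
    show (2 * i + j + 2 * p + 1) / 2 = i + (j + 1) / 2 + p by omega, this,
    show (2 * i + j + 2 * p + 1) % 2 = (2 * i + j + 1) % 2 by omega]

/-- The set of infinite overlap-free words. -/
def overlapFree : Set (ℕ → Bool) := {w | ∀ i p, ¬ HasOverlapAt w i p}

/-- Overlap-free words starting with two distinct letters. -/
def startsAB : Set (ℕ → Bool) := {w | w ∈ overlapFree ∧ w 0 ≠ w 1}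

/-- Overlap-free words starting with a square of a letter. -/
def startsAA : Set (ℕ → Bool) := {w | w ∈ overlapFree ∧ w 0 = w 1}

/-- Overlap-free words starting with `0010` or `1101`. -/
def startsAABA : Set (ℕ → Bool) := {w | w ∈ overlapFree ∧ w 0 = w 1 ∧ w 1 ≠ w 2 ∧ w 2 ≠ w 3}

/-- Overlap-free words starting with `011` or `100`. -/
def startsABB : Set (ℕ → Bool) := {w | w ∈ overlapFree ∧ w 0 ≠ w 1 ∧ w 1 = w 2}

theorem overlapFree_of_shift {w w' : ℕ → Bool} (k : ℕ) (hw : w ∈ overlapFree)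
    (h : ∀ n, w' n = w (n + k)) : w' ∈ overlapFree := by
  rintro i p ⟨hp, hov⟩
  refine hw (i + k) p ⟨hp, fun j hj => ?_⟩
  have := hov j hj
  rw [h, h] at this
  rwa [show i + k + j = i + j + k by omega, show i + j + k + p = i + j + p + k by omega]

theorem morph_mem {v : ℕ → Bool} (hv : v ∈ overlapFree) : morph v ∈ overlapFree :=
  fun _ _ h => hv _ _ h.of_morph

theorem morphTail_mem {v : ℕ → Bool} (hv : v ∈ overlapFree) : morphTail v ∈ overlapFree :=
  overlapFree_of_shift 1 (morph_mem hv) fun _ => rfl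

theorem mem_of_morphTail_mem {v : ℕ → Bool} (hv : morphTail v ∈ overlapFree) :
    v ∈ overlapFree :=
  fun _ _ h => hv _ _ h.morphTail

theorem morphFlip_mem {v : ℕ → Bool} (hv : v ∈ startsAABA) : morphFlip v ∈ overlapFree := by
  obtain ⟨hv, h01, h12, h23⟩ := hv
  rintro i p ⟨hp, hov⟩
  by_cases hi : 0 < i
  · refine morph_mem hv i p ⟨hp, fun j hj => ?_⟩
    have := hov j hj
    rwa [morphFlip_of_pos _ (by omega), morphFlip_of_pos _ (by omega)] at this
  obtain rfl : i = 0 := by omega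
  simp only [zero_add] at hov
  have e0 : morphFlip v 0 = !v 0 := by simp [morphFlip, morph]
  have e1 : morphFlip v 1 = !v 0 := by simp [morphFlip, morph]
  have e2 : morphFlip v 2 = v 1 := by simp [morphFlip, morph]
  have e3 : morphFlip v 3 = !v 1 := by simp [morphFlip, morph]
  have e4 : morphFlip v 4 = v 2 := by simp [morphFlip, morph]
  have e6 : morphFlip v 6 = v 3 := by simp [morphFlip, morph]
  rcases Nat.mod_two_eq_zero_or_one p with hp2 | hp2
  · have h0 := hov 0 (by omega)
    have h1 := hov 1 (by omega)
    have hne := morph_succ_ne (v := v) hp2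
    rw [e0, morphFlip_of_pos _ (by omega), zero_add] at h0
    rw [e1, morphFlip_of_pos _ (by omega), add_comm] at h1
    exact hne (h0.symm.trans h1)
  · by_cases h5 : 5 ≤ p
    · have h3 := hov 3 (by omega)
      have h4 := hov 4 (by omega)
      have hne := morph_succ_ne (v := v) (m := 3 + p) (by omega)
      rw [e3, morphFlip_of_pos _ (by omega)] at h3
      rw [e4, morphFlip_of_pos _ (by omega), show 4 + p = 3 + p + 1 by omega] at h4
      rw [← h3, ← h4] at hne
      grind
    · obtain rfl | rfl : p = 1 ∨ p = 3 := by omega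
      · have h1 := hov 1 le_rfl
        norm_num at h1
        grind
      · have h3 := hov 3 le_rfl
        norm_num at h3
        grind

theorem not_three_eq {w : ℕ → Bool} (hw : w ∈ overlapFree) (m : ℕ) :
    ¬ (w m = w (m + 1) ∧ w (m + 1) = w (m + 2)) := by
  rintro ⟨h₁, h₂⟩
  refine hw m 1 ⟨one_pos, fun j hj => ?_⟩
  interval_cases j <;> assumption

theorem not_alternating {w : ℕ → Bool} (hw : w ∈ overlapFree) (m : ℕ) :
    ¬ (w m ≠ w (m + 1) ∧ w (m + 1) ≠ w (m + 2) ∧ w (m + 2) ≠ w (m + 3) ∧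
      w (m + 3) ≠ w (m + 4)) := by
  rintro ⟨h₁, h₂, h₃, h₄⟩
  refine hw m 2 ⟨two_pos, fun j hj => ?_⟩
  rw [← Bool.eq_not] at h₁ h₂ h₃ h₄
  interval_cases j <;> simp only [add_assoc, Nat.reduceAdd, add_zero] <;> simp [*]

theorem not_overlap_period_three {w : ℕ → Bool} (hw : w ∈ overlapFree) (m : ℕ) :
    ¬ (w m = w (m + 3) ∧ w (m + 1) = w (m + 4) ∧ w (m + 2) = w (m + 5) ∧
      w (m + 3) = w (m + 6)) := by
  rintro ⟨h₁, h₂, h₃, h₄⟩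
  refine hw m 3 ⟨three_pos, fun j hj => ?_⟩
  interval_cases j <;> assumption

/-- Away from the start, equal adjacent letters of an overlap-free word occur at positions of a
fixed parity. -/
theorem even_distance {w : ℕ → Bool} (hw : w ∈ overlapFree) (d : ℕ) :
    ∀ m, 1 ≤ m → w m = w (m + 1) → w (m + d) = w (m + d + 1) → d % 2 = 0 := by
  induction d using Nat.strong_induction_on with
  | _ d ih =>
    intro m hm h₁ h₂
    by_cases hd : d ≤ 4
    · interval_cases d
      · rfl
      · exact (not_three_eq hw m ⟨h₁, h₂⟩).elim
      · rfl
      · obtain ⟨k, rfl⟩ : ∃ k, m = k + 1 := ⟨m - 1, by omega⟩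
        have t₀ := not_three_eq hw k
        have t₁ := not_three_eq hw (k + 1)
        have t₂ := not_three_eq hw (k + 2)
        have t₃ := not_three_eq hw (k + 3)
        have t₄ := not_three_eq hw (k + 4)
        have s := not_overlap_period_three hw k
        simp only [add_assoc, Nat.reduceAdd] at h₁ h₂ t₀ t₁ t₂ t₃ t₄ s
        revert h₁ h₂ t₀ t₁ t₂ t₃ t₄ s
        generalize w k = a₀, w (k + 1) = a₁, w (k + 2) = a₂, w (k + 3) = a₃, w (k + 4) = a₄,
          w (k + 5) = a₅, w (k + 6) = a₆
        revert a₀ a₁ a₂ a₃ a₄ a₅ a₆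
        set_option synthInstance.maxSize 2000 in
        decide
      · rfl
    · obtain ⟨e, he₁, he₄, he⟩ : ∃ e, 1 ≤ e ∧ e ≤ 4 ∧ w (m + e) = w (m + e + 1) := by
        by_contra! hne
        exact not_alternating hw (m + 1) ⟨hne 1 (by omega) (by omega), hne 2 (by omega) (by omega),
          hne 3 (by omega) (by omega), hne 4 (by omega) le_rfl⟩
      have := ih e (by omega) m hm h₁ he
      have := ih (d - e) (by omega) (m + e) (by omega) he
        (by rwa [show m + e + (d - e) = m + d by omega])
      omega

theorem exists_parity {w : ℕ → Bool} (hw : w ∈ overlapFree) :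
    (∀ m, 1 ≤ m → m % 2 = 0 → w m ≠ w (m + 1)) ∨
      (∀ m, m % 2 = 1 → w m ≠ w (m + 1)) := by
  by_contra! h
  obtain ⟨⟨m, hm, hm2, h₁⟩, k, hk2, h₂⟩ := h
  rcases le_total m k with hmk | hmk
  · have := even_distance hw (k - m) m hm h₁ (by rwa [show m + (k - m) = k by omega])
    omega
  · have := even_distance hw (m - k) k (by omega) h₂ (by rwa [show k + (m - k) = m by omega])
    omega

theorem eq_morph {w : ℕ → Bool} (h : ∀ m, m % 2 = 0 → w m ≠ w (m + 1)) :
    w = morph fun k => w (2 * k) := by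
  funext n
  rcases Nat.mod_two_eq_zero_or_one n with hn | hn
  · obtain ⟨k, rfl⟩ : ∃ k, n = 2 * k := ⟨n / 2, by omega⟩
    rw [morph_two_mul]
  · obtain ⟨k, rfl⟩ : ∃ k, n = 2 * k + 1 := ⟨n / 2, by omega⟩
    rw [morph_two_mul_add_one]
    exact Bool.eq_not.2 (h (2 * k) (by omega)).symm

theorem eq_morphTail {w : ℕ → Bool} (h : ∀ m, m % 2 = 1 → w m ≠ w (m + 1)) :
    ∃ v, w = morphTail v := by
  let w' : ℕ → Bool := fun n => if n = 0 then !w 0 else w (n - 1)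
  refine ⟨fun k => w' (2 * k), ?_⟩
  rw [funext_iff]
  intro n
  have := eq_morph (w := w') fun m hm => by
    by_cases hm0 : m = 0
    · simp [w', hm0]
    · have := h (m - 1) (by omega)
      rw [show m - 1 + 1 = m by omega] at this
      simpa [w', hm0] using this
  rw [morphTail, ← this]
  simp [w']

theorem eq_morphFlip {w : ℕ → Bool} (h₀ : w 0 = w 1)
    (h : ∀ m, 1 ≤ m → m % 2 = 0 → w m ≠ w (m + 1)) : ∃ v, w = morphFlip v := by
  let w' : ℕ → Bool := fun n => w n ^^ decide (n = 0)
  refine ⟨fun k => w' (2 * k), ?_⟩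
  have := eq_morph (w := w') fun m hm => by
    by_cases hm0 : m = 0
    · simp [w', hm0, h₀]
    · simpa [w', hm0] using h m (by omega) hm
  funext n
  rw [morphFlip, ← this]
  simp [w']

theorem mem_startsAABA_of_morphFlip_mem {v : ℕ → Bool} (hv : morphFlip v ∈ overlapFree) :
    v ∈ startsAABA := by
  have hmem : v ∈ overlapFree := mem_of_morphTail_mem
    (overlapFree_of_shift 1 hv fun n => (morphFlip_of_pos v n.succ_pos).symm)
  have a0 := not_alternating hv 1
  have t0 := not_three_eq hv 0
  have t3 := not_three_eq hv 3
  have s := not_overlap_period_three hv 0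
  have e0 : morphFlip v 0 = !v 0 := by simp [morphFlip, morph]
  have e1 : morphFlip v 1 = !v 0 := by simp [morphFlip, morph]
  have e2 : morphFlip v 2 = v 1 := by simp [morphFlip, morph]
  have e3 : morphFlip v 3 = !v 1 := by simp [morphFlip, morph]
  have e4 : morphFlip v 4 = v 2 := by simp [morphFlip, morph]
  have e5 : morphFlip v 5 = !v 2 := by simp [morphFlip, morph]
  have e6 : morphFlip v 6 = v 3 := by simp [morphFlip, morph]
  simp only [Nat.reduceAdd, e0, e1, e2, e3, e4, e5, e6] at a0 t0 t3 s
  refine ⟨hmem, ?_⟩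
  revert a0 t0 t3 s
  generalize v 0 = b₀, v 1 = b₁, v 2 = b₂, v 3 = b₃
  revert b₀ b₁ b₂ b₃
  set_option synthInstance.maxSize 2000 in
  decide

theorem mem_overlapFree_cases {w : ℕ → Bool} (hw : w ∈ overlapFree) :
    (∃ v ∈ overlapFree, w = morph v) ∨ (∃ v ∈ overlapFree, w = morphTail v) ∨
      ∃ v ∈ startsAABA, w = morphFlip v := by
  rcases exists_parity hw with h | h
  · by_cases h₀ : w 0 = w 1
    · obtain ⟨v, rfl⟩ := eq_morphFlip h₀ h
      exact Or.inr (Or.inr ⟨v, mem_startsAABA_of_morphFlip_mem hw, rfl⟩)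
    · have := eq_morph (w := w) fun m hm => by
        by_cases hm0 : m = 0
        · simpa [hm0] using h₀
        · exact h m (by omega) hm
      refine Or.inl ⟨_, mem_of_morphTail_mem ?_, this⟩
      exact overlapFree_of_shift 1 hw fun n => by rw [this]; simp [morphTail, morph_two_mul]
  · obtain ⟨v, rfl⟩ := eq_morphTail h
    exact Or.inr (Or.inl ⟨v, mem_of_morphTail_mem hw, rfl⟩)

theorem overlapFree_eq : overlapFree = startsAB ∪ startsAA := by
  ext w
  by_cases h : w 0 = w 1 <;> simp [startsAB, startsAA, h]

theorem startsAB_eq :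
    startsAB = morph '' startsAB ∪ morph '' startsAA ∪ morphTail '' startsAA := by
  apply Set.Subset.antisymm
  · rintro w ⟨hw, h01⟩
    rcases mem_overlapFree_cases hw with ⟨v, hv, rfl⟩ | ⟨v, hv, rfl⟩ | ⟨v, hv, rfl⟩
    · left
      rw [← Set.image_union, ← overlapFree_eq]
      exact ⟨v, hv, rfl⟩
    · exact Or.inr ⟨v, ⟨hv, by simpa [morphTail, morph, ← Bool.eq_not] using h01⟩, rfl⟩
    · simp [morphFlip, morph] at h01
  · rintro w ((⟨v, hv, rfl⟩ | ⟨v, hv, rfl⟩) | ⟨v, hv, rfl⟩)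
    · exact ⟨morph_mem hv.1, by simp [morph]⟩
    · exact ⟨morph_mem hv.1, by simp [morph]⟩
    · exact ⟨morphTail_mem hv.1, by simp [morphTail, morph, hv.2]⟩

theorem startsAA_eq : startsAA = morphTail '' startsAB ∪ morphFlip '' startsAABA := by
  apply Set.Subset.antisymm
  · rintro w ⟨hw, h01⟩
    rcases mem_overlapFree_cases hw with ⟨v, hv, rfl⟩ | ⟨v, hv, rfl⟩ | ⟨v, hv, rfl⟩
    · simp [morph] at h01
    · exact Or.inl ⟨v, ⟨hv, by simpa [morphTail, morph, Bool.eq_not, eq_comm] using h01⟩, rfl⟩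
    · exact Or.inr ⟨v, hv, rfl⟩
  · rintro w (⟨v, hv, rfl⟩ | ⟨v, hv, rfl⟩)
    · exact ⟨morphTail_mem hv.1, by simp [morphTail, morph, Bool.eq_not.2 hv.2]⟩
    · exact ⟨morphFlip_mem hv, by simp [morphFlip, morph]⟩

theorem startsAABA_eq :
    startsAABA = morphTail '' startsABB ∪ morphFlip '' startsAABA := by
  apply Set.Subset.antisymm
  · rintro w ⟨hw, h01, h12, h23⟩
    rcases mem_overlapFree_cases hw with ⟨v, hv, rfl⟩ | ⟨v, hv, rfl⟩ | ⟨v, hv, rfl⟩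
    · simp [morph] at h01
    · refine Or.inl ⟨v, ⟨hv, ?_⟩, rfl⟩
      simpa [morphTail, morph, Bool.not_eq_eq_eq_not, Bool.eq_not] using And.intro h01 h23
    · exact Or.inr ⟨v, hv, rfl⟩
  · rintro w (⟨v, ⟨hv, h01, h12⟩, rfl⟩ | ⟨v, hv, rfl⟩)
    · refine ⟨morphTail_mem hv, ?_⟩
      simp [morphTail, morph, ← h12, Bool.eq_not.2 h01]
    · refine ⟨morphFlip_mem hv, ?_⟩
      obtain ⟨-, h01, -⟩ := hv
      simp [morphFlip, morph, h01]

theorem startsABB_eq : startsABB = morph '' startsAB := by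
  apply Set.Subset.antisymm
  · rintro w ⟨hw, h01, h12⟩
    rcases mem_overlapFree_cases hw with ⟨v, hv, rfl⟩ | ⟨v, hv, rfl⟩ | ⟨v, hv, rfl⟩
    · exact ⟨v, ⟨hv, by simpa [morph, eq_comm, Bool.eq_not] using h12⟩, rfl⟩
    · simp [morphTail, morph] at h12
    · simp [morphFlip, morph] at h01
  · rintro w ⟨v, hv, rfl⟩
    exact ⟨morph_mem hv.1, by simp [morph, Bool.eq_not.2 hv.2]⟩

theorem thueMorse_eq_morph : thueMorse = morph thueMorse := by
  funext n
  rcases Nat.eq_zero_or_pos n with rfl | hn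
  · simp [morph]
  · simp only [thueMorse, morph]
    rw [Nat.digits_def' one_lt_two hn, List.count_cons]
    generalize List.count 1 (Nat.digits 2 (n / 2)) = k
    rcases Nat.mod_two_eq_zero_or_one n with h | h <;>
      rcases Nat.mod_two_eq_zero_or_one k with h' | h' <;> simp [h, h', Nat.add_mod]

theorem thueMorse_mem : thueMorse ∈ overlapFree := by
  intro i p
  induction p using Nat.strong_induction_on generalizing i with
  | _ p ih =>
    intro h
    have h' := h
    rw [thueMorse_eq_morph] at h'
    exact ih _ (Nat.div_lt_self h.1 one_lt_two) _ h'.of_morph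

theorem startsAB_nonempty : startsAB.Nonempty :=
  ⟨morph thueMorse, morph_mem thueMorse_mem, by simp [morph]⟩

theorem startsABB_nonempty : startsABB.Nonempty := by
  rw [startsABB_eq]
  exact startsAB_nonempty.image _

theorem startsAABA_nonempty : startsAABA.Nonempty := by
  rw [startsAABA_eq]
  exact (startsABB_nonempty.image _).inl

theorem startsAA_nonempty : startsAA.Nonempty := by
  rw [startsAA_eq]
  exact (startsAB_nonempty.image _).inl

/-- The prefix of length `n` of an infinite word. -/
def pre (n : ℕ) (w : ℕ → Bool) : List Bool := List.ofFn fun i : Fin n => w i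

theorem pre_eq_iff {n : ℕ} {v w : ℕ → Bool} : pre n v = pre n w ↔ ∀ i < n, v i = w i := by
  rw [pre, pre, List.ofFn_inj, funext_iff]
  exact ⟨fun h i hi => h ⟨i, hi⟩, fun h i => h i i.2⟩

/-- The number of prefixes of length `n` of the words in `P`. -/
noncomputable def prefixCount (P : Set (ℕ → Bool)) (n : ℕ) : ℕ := (pre n '' P).ncard

theorem finite_pre_image (P : Set (ℕ → Bool)) (n : ℕ) : (pre n '' P).Finite := by
  refine (List.finite_length_eq Bool n).subset ?_
  rintro _ ⟨w, -, rfl⟩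
  simp [pre]

theorem ncard_image_le_of_factors {α β γ : Type*} {s : Set α} {f : α → β} {g : α → γ}
    (hs : (f '' s).Finite) (h : ∀ x ∈ s, ∀ y ∈ s, f x = f y → g x = g y) :
    (g '' s).ncard ≤ (f '' s).ncard := by
  classical
  rcases s.eq_empty_or_nonempty with rfl | ⟨x₀, -⟩
  · simp
  let k : β → γ := fun b => if hb : ∃ x ∈ s, f x = b then g hb.choose else g x₀
  refine (Set.ncard_le_ncard ?_ (hs.image k)).trans (Set.ncard_image_le hs)
  rintro _ ⟨x, hx, rfl⟩
  refine ⟨f x, ⟨x, hx, rfl⟩, ?_⟩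
  have hb : ∃ y ∈ s, f y = f x := ⟨x, hx, rfl⟩
  simp only [k, dif_pos hb]
  exact h _ hb.choose_spec.1 _ hx hb.choose_spec.2

theorem prefixCount_image {f : (ℕ → Bool) → ℕ → Bool} {n m : ℕ} (Q : Set (ℕ → Bool))
    (h : ∀ v w, pre n (f v) = pre n (f w) ↔ pre m v = pre m w) :
    prefixCount (f '' Q) n = prefixCount Q m := by
  have hfin := finite_pre_image (f '' Q) n
  rw [prefixCount, prefixCount, ← Set.image_comp]
  rw [← Set.image_comp] at hfin
  exact le_antisymm
    (ncard_image_le_of_factors (finite_pre_image Q m) fun v _ w _ => (h v w).2)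
    (ncard_image_le_of_factors hfin fun v _ w _ => (h v w).1)

theorem prefixCount_union {P Q : Set (ℕ → Bool)} {n : ℕ}
    (h : ∀ v ∈ P, ∀ w ∈ Q, ¬ ∀ i < n, v i = w i) :
    prefixCount (P ∪ Q) n = prefixCount P n + prefixCount Q n := by
  rw [prefixCount, Set.image_union]
  refine Set.ncard_union_eq ?_ (finite_pre_image P n) (finite_pre_image Q n)
  rw [Set.disjoint_left]
  rintro _ ⟨v, hv, rfl⟩ ⟨w, hw, hvw⟩
  exact h v hv w hw fun i hi => (pre_eq_iff.1 hvw i hi).symm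

theorem prefixCount_pos {P : Set (ℕ → Bool)} (hP : P.Nonempty) (n : ℕ) : 1 ≤ prefixCount P n :=
  (Set.ncard_pos (finite_pre_image P n)).2 (hP.image _)

theorem morph_apply_eq_iff {v w : ℕ → Bool} {n : ℕ} :
    morph v n = morph w n ↔ v (n / 2) = w (n / 2) := by
  simp [morph]

theorem prefixCount_morph (Q : Set (ℕ → Bool)) (n : ℕ) :
    prefixCount (morph '' Q) n = prefixCount Q ((n + 1) / 2) := by
  refine prefixCount_image Q fun v w => ?_
  simp only [pre_eq_iff, morph_apply_eq_iff]
  refine ⟨fun h i hi => ?_, fun h i hi => h _ (by omega)⟩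
  simpa using h (2 * i) (by omega)

theorem prefixCount_morphFlip (Q : Set (ℕ → Bool)) (n : ℕ) :
    prefixCount (morphFlip '' Q) n = prefixCount Q ((n + 1) / 2) := by
  refine prefixCount_image Q fun v w => ?_
  simp only [pre_eq_iff, morphFlip, Bool.xor_left_inj, morph_apply_eq_iff]
  refine ⟨fun h i hi => ?_, fun h i hi => h _ (by omega)⟩
  simpa using h (2 * i) (by omega)

theorem prefixCount_morphTail (Q : Set (ℕ → Bool)) {n : ℕ} (hn : 1 ≤ n) :
    prefixCount (morphTail '' Q) n = prefixCount Q (n / 2 + 1) := by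
  refine prefixCount_image Q fun v w => ?_
  simp only [pre_eq_iff, morphTail, morph_apply_eq_iff]
  refine ⟨fun h i hi => ?_, fun h i hi => h _ (by omega)⟩
  rcases Nat.eq_zero_or_pos i with rfl | hi0
  · exact h 0 hn
  · have := h (2 * i - 1) (by omega)
    rwa [show (2 * i - 1 + 1) / 2 = i by omega] at this

theorem morphTail_succ_ne {v : ℕ → Bool} {m : ℕ} (hm : m % 2 = 1) :
    morphTail v m ≠ morphTail v (m + 1) :=
  morph_succ_ne (by omega)

theorem morphFlip_succ_ne {v : ℕ → Bool} {m : ℕ} (h₀ : 0 < m) (hm : m % 2 = 0) :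
    morphFlip v m ≠ morphFlip v (m + 1) := by
  rw [morphFlip_of_pos v h₀, morphFlip_of_pos v m.succ_pos]
  exact morph_succ_ne hm

theorem prefixCount_overlapFree {n : ℕ} (hn : 2 ≤ n) :
    prefixCount overlapFree n = prefixCount startsAB n + prefixCount startsAA n := by
  rw [overlapFree_eq]
  refine prefixCount_union fun v hv w hw h => hv.2 ?_
  rw [h 0 (by omega), h 1 (by omega), hw.2]

theorem prefixCount_startsAB {n : ℕ} (hn : 6 ≤ n) :
    prefixCount startsAB n = prefixCount startsAB ((n + 1) / 2) +
      prefixCount startsAA ((n + 1) / 2) + prefixCount startsAA (n / 2 + 1) := by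
  conv_lhs => rw [startsAB_eq]
  rw [prefixCount_union, prefixCount_union, prefixCount_morph, prefixCount_morph,
    prefixCount_morphTail _ (by omega)]
  · rintro _ ⟨v, hv, rfl⟩ _ ⟨w, hw, rfl⟩ h
    have h₀ := h 0 (by omega)
    have h₂ := h 2 (by omega)
    rw [morph_apply_eq_iff] at h₀ h₂
    exact hv.2 (by simpa [hw.2] using h₀.trans (hw.2.trans h₂.symm))
  · rw [← Set.image_union, ← overlapFree_eq]
    rintro _ ⟨v, hv, rfl⟩ _ ⟨w, hw, rfl⟩ h
    refine not_alternating (morph_mem hv) 0 ⟨morph_succ_ne rfl, ?_, morph_succ_ne rfl, ?_⟩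
    · rw [h _ (by omega), h _ (by omega)]
      exact morphTail_succ_ne rfl
    · rw [h _ (by omega), h _ (by omega)]
      exact morphTail_succ_ne rfl

theorem not_morphTail_morphFlip {n : ℕ} (hn : 6 ≤ n) {v w : ℕ → Bool} (hv : v ∈ overlapFree) :
    ¬ ∀ i < n, morphTail v i = morphFlip w i := by
  intro h
  refine not_alternating (morphTail_mem hv) 1
    ⟨morphTail_succ_ne rfl, ?_, morphTail_succ_ne rfl, ?_⟩
  · rw [h _ (by omega), h _ (by omega)]
    exact morphFlip_succ_ne (by omega) rfl
  · rw [h _ (by omega), h _ (by omega)]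
    exact morphFlip_succ_ne (by omega) rfl

theorem prefixCount_startsAA {n : ℕ} (hn : 6 ≤ n) :
    prefixCount startsAA n =
      prefixCount startsAB (n / 2 + 1) + prefixCount startsAABA ((n + 1) / 2) := by
  conv_lhs => rw [startsAA_eq]
  rw [prefixCount_union, prefixCount_morphTail _ (by omega), prefixCount_morphFlip]
  rintro _ ⟨v, hv, rfl⟩ _ ⟨w, -, rfl⟩
  exact not_morphTail_morphFlip hn hv.1

theorem prefixCount_startsAABA {n : ℕ} (hn : 6 ≤ n) :
    prefixCount startsAABA n =
      prefixCount startsABB (n / 2 + 1) + prefixCount startsAABA ((n + 1) / 2) := by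
  conv_lhs => rw [startsAABA_eq]
  rw [prefixCount_union, prefixCount_morphTail _ (by omega), prefixCount_morphFlip]
  rintro _ ⟨v, hv, rfl⟩ _ ⟨w, -, rfl⟩
  exact not_morphTail_morphFlip hn hv.1

theorem prefixCount_startsABB (n : ℕ) :
    prefixCount startsABB n = prefixCount startsAB ((n + 1) / 2) := by
  rw [startsABB_eq, prefixCount_morph]

theorem E_eq_prefixCount (n : ℕ) : E n = prefixCount overlapFree n := by
  have hset : {x : List Bool | x.length = n ∧ ∃ y, OverlapFreeSeq (appendSeq x y)} =
      pre n '' overlapFree := by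
    ext x
    simp only [overlapFreeSeq_iff, Set.mem_image, Set.mem_ofPred_eq]
    constructor
    · rintro ⟨rfl, y, hy⟩
      refine ⟨appendSeq x y, hy, ?_⟩
      apply List.ext_getElem <;> simp [pre, appendSeq]
    · rintro ⟨w, hw, rfl⟩
      refine ⟨by simp [pre], fun k => w (n + k), ?_⟩
      have : appendSeq (pre n w) (fun k => w (n + k)) = w := by
        funext k
        by_cases hk : k < n
        · simp [appendSeq, pre, hk]
        · simp only [appendSeq, pre, List.length_ofFn, hk, dite_false]
          congr 1
          omega
      rwa [this]
  rw [E, prefixCount, ← hset]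
  rfl

end BinarySeq

theorem two_lt_zeta : 2 < zeta := by
  have h₁ : 1 < √(3 : ℝ) := by rw [Real.lt_sqrt] <;> norm_num
  have h₂ : 3 < √(5 + 4 * √(3 : ℝ)) := by rw [Real.lt_sqrt (by norm_num)]; linarith
  rw [zeta]
  linarith

theorem zeta_quartic : (zeta * (zeta - 1)) ^ 2 = 2 * (zeta * (zeta - 1)) + 2 := by
  have h₁ : √(3 : ℝ) ^ 2 = 3 := Real.sq_sqrt (by norm_num)
  have h₂ : √(5 + 4 * √(3 : ℝ)) ^ 2 = 5 + 4 * √(3 : ℝ) := Real.sq_sqrt (by positivity)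
  have h₃ : zeta * (zeta - 1) = 1 + √3 := by
    rw [zeta]
    linear_combination h₂ / 4
  rw [h₃]
  linear_combination h₁

theorem logb_zeta_nonneg : 0 ≤ Real.logb 2 zeta :=
  Real.logb_nonneg one_lt_two (by linarith [two_lt_zeta])

theorem zeta_mul_half_rpow {x : ℝ} (hx : 0 ≤ x) :
    zeta * (x / 2) ^ Real.logb 2 zeta = x ^ Real.logb 2 zeta := by
  have hz : (0 : ℝ) < zeta := by linarith [two_lt_zeta]
  rw [Real.div_rpow hx two_pos.le, Real.rpow_logb two_pos (by norm_num) hz]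
  field_simp

/-- The system of recurrences satisfied by the numbers of prefixes of overlap-free words in four
classes. -/
structure DivideRecurrence (a b f g : ℕ → ℝ) : Prop where
  a_eq : ∀ n, 6 ≤ n → a n = a ((n + 1) / 2) + b ((n + 1) / 2) + b (n / 2 + 1)
  b_eq : ∀ n, 6 ≤ n → b n = a (n / 2 + 1) + f ((n + 1) / 2)
  f_eq : ∀ n, 6 ≤ n → f n = g (n / 2 + 1) + f ((n + 1) / 2)
  g_eq : ∀ n, 6 ≤ n → g n = a ((n + 1) / 2)

namespace DivideRecurrence

variable {a b f g : ℕ → ℝ}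

theorem lower_bound (h : DivideRecurrence a b f g)
    (hpos : ∀ n, 1 ≤ a n ∧ 1 ≤ b n ∧ 1 ≤ f n ∧ 1 ≤ g n) :
    ∃ C : ℝ, 0 < C ∧ ∀ n : ℕ, 1 ≤ n → C * (n : ℝ) ^ Real.logb 2 zeta ≤ a n := by
  have hz := two_lt_zeta
  have hq := zeta_quartic
  have hc := logb_zeta_nonneg
  have hhalf := @zeta_mul_half_rpow
  set z := zeta
  set c := Real.logb 2 z
  obtain ⟨u, hu⟩ : ∃ u, u = z * (z - 1) := ⟨_, rfl⟩
  rw [← hu] at hq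
  have hu2 : 2 < u := by nlinarith
  obtain ⟨k, hk⟩ : ∃ k, k = (z - 1) * u / 2 := ⟨_, rfl⟩
  have hk1 : 1 ≤ k := by nlinarith
  obtain ⟨s, hs⟩ : ∃ s, s = u + k + 1 + z := ⟨_, rfl⟩
  have h6 : (0 : ℝ) < 6 ^ c := by positivity
  have hs0 : 0 < s := by linarith
  obtain ⟨C, hC⟩ : ∃ C, C = (s * 6 ^ c)⁻¹ := ⟨_, rfl⟩
  have hC0 : 0 < C := by rw [hC]; positivity
  have key : ∀ n : ℕ, 1 ≤ n → u * (C * (n : ℝ) ^ c) ≤ a n ∧ k * (C * (n : ℝ) ^ c) ≤ b n ∧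
      C * (n : ℝ) ^ c ≤ f n ∧ (z - 1) * (C * (n : ℝ) ^ c) ≤ g n := by
    intro n
    induction n using Nat.strong_induction_on with
    | _ n ih =>
      intro hn
      by_cases hn6 : n < 6
      · have hle : C * (n : ℝ) ^ c ≤ C * 6 ^ c := by
          have : (n : ℝ) ≤ 6 := by exact_mod_cast hn6.le
          gcongr
        have hnn : 0 ≤ C * (n : ℝ) ^ c := by positivity
        have hone : s * (C * (n : ℝ) ^ c) ≤ 1 := by
          calc s * (C * (n : ℝ) ^ c) ≤ s * (C * 6 ^ c) := by gcongr
            _ = 1 := by rw [hC]; field_simp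
        obtain ⟨h₁, h₂, h₃, h₄⟩ := hpos n
        refine ⟨?_, ?_, ?_, ?_⟩ <;> nlinarith
      · have hn6 : 6 ≤ n := by omega
        have hmono : ∀ m : ℕ, (n : ℝ) / 2 ≤ m → C * ((n : ℝ) / 2) ^ c ≤ C * (m : ℝ) ^ c :=
          fun m hm => by gcongr
        have hm₁ : (n : ℝ) / 2 ≤ ((n + 1) / 2 : ℕ) := by
          have : n ≤ 2 * ((n + 1) / 2) := by omega
          have : (n : ℝ) ≤ 2 * ((n + 1) / 2 : ℕ) := by exact_mod_cast this
          linarith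
        have hm₂ : (n : ℝ) / 2 ≤ (n / 2 + 1 : ℕ) := by
          have : n ≤ 2 * (n / 2 + 1) := by omega
          have : (n : ℝ) ≤ 2 * (n / 2 + 1 : ℕ) := by exact_mod_cast this
          linarith
        obtain ⟨a₁, b₁, f₁, g₁⟩ := ih ((n + 1) / 2) (by omega) (by omega)
        obtain ⟨a₂, b₂, f₂, g₂⟩ := ih (n / 2 + 1) (by omega) (by omega)
        have p₁ := hmono _ hm₁
        have p₂ := hmono _ hm₂
        have hx := hhalf (x := n) (by positivity)
        rw [h.a_eq n hn6, h.b_eq n hn6, h.f_eq n hn6, h.g_eq n hn6, ← hx]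
        generalize (n / 2 : ℝ) ^ c = x at *
        generalize (((n + 1) / 2 : ℕ) : ℝ) ^ c = y₁ at *
        generalize ((n / 2 + 1 : ℕ) : ℝ) ^ c = y₂ at *
        have q₁ := mul_le_mul_of_nonneg_left p₁ (by linarith : 0 ≤ u)
        have q₂ := mul_le_mul_of_nonneg_left p₂ (by linarith : 0 ≤ u)
        have r₁ := mul_le_mul_of_nonneg_left p₁ (by linarith : 0 ≤ k)
        have r₂ := mul_le_mul_of_nonneg_left p₂ (by linarith : 0 ≤ k)
        have t₂ := mul_le_mul_of_nonneg_left p₂ (by linarith : 0 ≤ z - 1)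
        have e₁ : u * (C * (z * x)) = u * (C * x) + 2 * (k * (C * x)) := by
          rw [hk]; ring
        have e₂ : k * (C * (z * x)) = u * (C * x) + C * x := by
          linear_combination hk * (C * (z * x)) - u * C * x / 2 * hu + hq * (C * x) / 2
        have e₃ : (z - 1) * (C * (z * x)) = u * (C * x) := by rw [hu]; ring
        refine ⟨?_, ?_, ?_, ?_⟩ <;> linarith
  refine ⟨C, hC0, fun n hn => ?_⟩
  have : 0 ≤ C * (n : ℝ) ^ c := by positivity
  nlinarith [(key n hn).1]

theorem upper_bound (h : DivideRecurrence a b f g)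
    (hpos : ∀ n, 1 ≤ a n ∧ 1 ≤ b n ∧ 1 ≤ f n ∧ 1 ≤ g n) :
    ∃ C : ℝ, 0 < C ∧ ∀ n : ℕ, 3 ≤ n → a n + b n ≤ C * (n : ℝ) ^ Real.logb 2 zeta := by
  have hz := two_lt_zeta
  have hq := zeta_quartic
  have hc := logb_zeta_nonneg
  have hhalf := @zeta_mul_half_rpow
  set z := zeta
  set c := Real.logb 2 z
  obtain ⟨u, hu⟩ : ∃ u, u = z * (z - 1) := ⟨_, rfl⟩
  rw [← hu] at hq
  have hu2 : 2 < u := by nlinarith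
  obtain ⟨k, hk⟩ : ∃ k, k = (z - 1) * u / 2 := ⟨_, rfl⟩
  have hk1 : 1 ≤ k := by nlinarith
  obtain ⟨C, hC⟩ : ∃ C, C = ∑ n ∈ Finset.range 6, (a n + b n + f n + g n) := ⟨_, rfl⟩
  have hle : ∀ n < 6, a n + b n + f n + g n ≤ C := fun n hn => by
    rw [hC]
    refine Finset.single_le_sum (f := fun n => a n + b n + f n + g n) (fun i _ => ?_)
      (Finset.mem_range.2 hn)
    obtain ⟨h₁, h₂, h₃, h₄⟩ := hpos i
    positivity
  have hC0 : 0 < C := by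
    have := hle 0 (by norm_num)
    obtain ⟨h₁, h₂, h₃, h₄⟩ := hpos 0
    linarith
  have key : ∀ n : ℕ, 3 ≤ n →
      a n ≤ u * (C * ((n : ℝ) - 2) ^ c) ∧ b n ≤ k * (C * ((n : ℝ) - 2) ^ c) ∧
      f n ≤ C * ((n : ℝ) - 2) ^ c ∧ g n ≤ (z - 1) * (C * ((n : ℝ) - 2) ^ c) := by
    intro n
    induction n using Nat.strong_induction_on with
    | _ n ih =>
      intro hn
      have hn3 : (3 : ℝ) ≤ n := by exact_mod_cast hn
      by_cases hn6 : n < 6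
      · have hone : 1 ≤ ((n : ℝ) - 2) ^ c := Real.one_le_rpow (by linarith) hc
        have hCle : C ≤ C * ((n : ℝ) - 2) ^ c := le_mul_of_one_le_right hC0.le hone
        have := hle n hn6
        obtain ⟨h₁, h₂, h₃, h₄⟩ := hpos n
        refine ⟨?_, ?_, ?_, ?_⟩ <;> nlinarith
      · have hn6 : 6 ≤ n := by omega
        have hmono : ∀ m : ℕ, 3 ≤ m → (m : ℝ) - 2 ≤ (n - 2) / 2 →
            C * ((m : ℝ) - 2) ^ c ≤ C * (((n : ℝ) - 2) / 2) ^ c := fun m hm3 hm => by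
          have : (3 : ℝ) ≤ m := by exact_mod_cast hm3
          have : (0 : ℝ) ≤ m - 2 := by linarith
          gcongr
        have hm₁ : (((n + 1) / 2 : ℕ) : ℝ) - 2 ≤ (n - 2) / 2 := by
          have : 2 * ((n + 1) / 2) ≤ n + 2 := by omega
          have : 2 * (((n + 1) / 2 : ℕ) : ℝ) ≤ n + 2 := by exact_mod_cast this
          linarith
        have hm₂ : ((n / 2 + 1 : ℕ) : ℝ) - 2 ≤ (n - 2) / 2 := by
          have : 2 * (n / 2 + 1) ≤ n + 2 := by omega
          have : 2 * ((n / 2 + 1 : ℕ) : ℝ) ≤ n + 2 := by exact_mod_cast this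
          linarith
        obtain ⟨a₁, b₁, f₁, g₁⟩ := ih ((n + 1) / 2) (by omega) (by omega)
        obtain ⟨a₂, b₂, f₂, g₂⟩ := ih (n / 2 + 1) (by omega) (by omega)
        have p₁ := hmono _ (by omega) hm₁
        have p₂ := hmono _ (by omega) hm₂
        have hx := hhalf (x := n - 2) (by linarith)
        rw [h.a_eq n hn6, h.b_eq n hn6, h.f_eq n hn6, h.g_eq n hn6, ← hx]
        generalize (((n : ℝ) - 2) / 2) ^ c = x at *
        generalize ((((n + 1) / 2 : ℕ) : ℝ) - 2) ^ c = y₁ at *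
        generalize (((n / 2 + 1 : ℕ) : ℝ) - 2) ^ c = y₂ at *
        have q₁ := mul_le_mul_of_nonneg_left p₁ (by linarith : 0 ≤ u)
        have q₂ := mul_le_mul_of_nonneg_left p₂ (by linarith : 0 ≤ u)
        have r₁ := mul_le_mul_of_nonneg_left p₁ (by linarith : 0 ≤ k)
        have r₂ := mul_le_mul_of_nonneg_left p₂ (by linarith : 0 ≤ k)
        have t₂ := mul_le_mul_of_nonneg_left p₂ (by linarith : 0 ≤ z - 1)
        have e₁ : u * (C * (z * x)) = u * (C * x) + 2 * (k * (C * x)) := by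
          rw [hk]; ring
        have e₂ : k * (C * (z * x)) = u * (C * x) + C * x := by
          linear_combination hk * (C * (z * x)) - u * C * x / 2 * hu + hq * (C * x) / 2
        have e₃ : (z - 1) * (C * (z * x)) = u * (C * x) := by rw [hu]; ring
        refine ⟨?_, ?_, ?_, ?_⟩ <;> linarith
  refine ⟨(u + k) * C, by positivity, fun n hn => ?_⟩
  have hn3 : (3 : ℝ) ≤ n := by exact_mod_cast hn
  have hmono : ((n : ℝ) - 2) ^ c ≤ (n : ℝ) ^ c :=
    Real.rpow_le_rpow (by linarith) (by linarith) hc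
  obtain ⟨h₁, h₂, -⟩ := key n hn
  calc a n + b n ≤ (u + k) * C * ((n : ℝ) - 2) ^ c := by linarith
    _ ≤ (u + k) * C * (n : ℝ) ^ c := by gcongr

end DivideRecurrence

theorem BinarySeq.divideRecurrence_prefixCount :
    DivideRecurrence (fun n => prefixCount startsAB n) (fun n => prefixCount startsAA n)
      (fun n => prefixCount startsAABA n) (fun n => prefixCount startsABB n) where
  a_eq n hn := by exact_mod_cast prefixCount_startsAB hn
  b_eq n hn := by exact_mod_cast prefixCount_startsAA hn
  f_eq n hn := by exact_mod_cast prefixCount_startsAABA hn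
  g_eq n _ := by exact_mod_cast prefixCount_startsABB n

/-- Kobayashi's theorem: E(n) = Θ(n^c) where c = log₂ ζ. -/
theorem E_theta_n_pow_c :
    ∃ C₁ C₂ : ℝ, 0 < C₁ ∧ 0 < C₂ ∧ ∀ n : ℕ, 1 ≤ n →
      C₁ * (n : ℝ) ^ Real.logb 2 zeta ≤ (E n : ℝ) ∧
      (E n : ℝ) ≤ C₂ * (n : ℝ) ^ Real.logb 2 zeta := by
  have hrec := BinarySeq.divideRecurrence_prefixCount
  have hpos : ∀ n, (1 : ℝ) ≤ BinarySeq.prefixCount BinarySeq.startsAB n ∧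
      (1 : ℝ) ≤ BinarySeq.prefixCount BinarySeq.startsAA n ∧
      (1 : ℝ) ≤ BinarySeq.prefixCount BinarySeq.startsAABA n ∧
      (1 : ℝ) ≤ BinarySeq.prefixCount BinarySeq.startsABB n := fun n =>
    ⟨by exact_mod_cast BinarySeq.prefixCount_pos BinarySeq.startsAB_nonempty n,
      by exact_mod_cast BinarySeq.prefixCount_pos BinarySeq.startsAA_nonempty n,
      by exact_mod_cast BinarySeq.prefixCount_pos BinarySeq.startsAABA_nonempty n,
      by exact_mod_cast BinarySeq.prefixCount_pos BinarySeq.startsABB_nonempty n⟩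
  obtain ⟨C₁, hC₁, hlow⟩ := hrec.lower_bound hpos
  obtain ⟨C₂, hC₂, hup⟩ := hrec.upper_bound hpos
  refine ⟨C₁, C₂ + E 1 + E 2, hC₁, by positivity, fun n hn => ⟨?_, ?_⟩⟩
  · refine (hlow n hn).trans ?_
    rw [BinarySeq.E_eq_prefixCount]
    have hsub : BinarySeq.startsAB ⊆ BinarySeq.overlapFree := fun w hw => hw.1
    exact_mod_cast Set.ncard_le_ncard (Set.image_mono hsub) (BinarySeq.finite_pre_image _ n)
  · have hone : 1 ≤ (n : ℝ) ^ Real.logb 2 zeta :=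
      Real.one_le_rpow (by exact_mod_cast hn) logb_zeta_nonneg
    have hE₁ : (0 : ℝ) ≤ E 1 := by positivity
    have hE₂ : (0 : ℝ) ≤ E 2 := by positivity
    by_cases hn3 : 3 ≤ n
    · have hE : (E n : ℝ) ≤ C₂ * (n : ℝ) ^ Real.logb 2 zeta := by
        rw [BinarySeq.E_eq_prefixCount, BinarySeq.prefixCount_overlapFree (by omega)]
        exact_mod_cast hup n hn3
      nlinarith
    · obtain rfl | rfl : n = 1 ∨ n = 2 := by omega
      · nlinarith
      · nlinarith
end

section
/- Let t ≥ 1 and let d_0, d_1, …, d_{t-1} ∈ S. Then μ^{t-1}(d_{t-1}) μ^{t-2}(d_{t-2}) ⋯ μ(d_1) d_0 equals the reversal of the word w = w_0 w_1 ⋯ w_{t-1}, where w_j = μ^j(d_j) if j is even and w_j = μ^j(d̄_j) if j is odd, d̄_j denoting the letterwise binary complement of d_j. -/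
theorem mu_append (u v : List Bool) : mu (u ++ v) = mu u ++ mu v := by
  simp [mu]

theorem mu_map_not (w : List Bool) : mu (w.map (fun b => !b)) = (mu w).map (fun b => !b) := by
  induction w with
  | nil => rfl
  | cons a w ih => simpa [mu] using ih

theorem iterate_mu_map_not (j : ℕ) (w : List Bool) :
    mu^[j] (w.map (fun b => !b)) = (mu^[j] w).map (fun b => !b) :=
  Function.Commute.iterate_left (g := List.map (fun b => !b)) mu_map_not j w

theorem reverse_mu (w : List Bool) : (mu w).reverse = (mu w.reverse).map (fun b => !b) := by
  induction w with
  | nil => rfl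
  | cons a w ih =>
    rw [← List.singleton_append, mu_append, List.reverse_append, List.reverse_append, mu_append,
      List.map_append, ih]
    simp [mu]

theorem reverse_iterate_mu (j : ℕ) (w : List Bool) :
    (mu^[j] w).reverse =
      if Even j then mu^[j] w.reverse else (mu^[j] w.reverse).map (fun b => !b) := by
  induction j with
  | zero => simp
  | succ j ih =>
    rw [Function.iterate_succ_apply', Function.iterate_succ_apply', reverse_mu, ih]
    by_cases h : Even j <;> simp [h, Nat.even_add_one, mu_map_not, Function.comp_def]

theorem reverse_eq_self_of_mem_S {w : List Bool} (hw : w ∈ S) : w.reverse = w := by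
  rcases hw with rfl | rfl | rfl | rfl | rfl <;> rfl

/-- For t ≥ 1 and d₀, …, d_{t-1} ∈ S, the word
μ^{t-1}(d_{t-1}) μ^{t-2}(d_{t-2}) ⋯ μ(d₁) d₀ is the reversal of
w = w₀ w₁ ⋯ w_{t-1}, where w_j = μ^j(d_j) for j even and w_j = μ^j(d̄_j)
for j odd. -/
theorem reversed_salemi_tail (t : ℕ) (ht : 1 ≤ t) (d : ℕ → List Bool)
    (hd : ∀ j < t, d j ∈ S) :
    (((List.range t).map (fun j => mu^[j] (d j))).reverse).flatten =
    (((List.range t).map (fun j =>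
        if Even j then mu^[j] (d j) else mu^[j] ((d j).map (fun b => !b)))).flatten).reverse := by
  rw [List.reverse_flatten, List.map_map]
  congr 2
  refine List.map_congr_left fun j hj => ?_
  have hrev := reverse_eq_self_of_mem_S (hd j (List.mem_range.mp hj))
  by_cases h : Even j
  · simp [h, reverse_iterate_mu, hrev]
  · simp [h, iterate_mu_map_not, ← List.map_reverse, reverse_iterate_mu, hrev, Function.comp_def]
end

section
/- For every infinite code word c ∈ 212{12,1112}^ω over the alphabet {1,2,3,4,5}, the infinite Restivo word R(c) avoids 7/3-powers and contains overlaps of infinitely many different periods; that is, the set of integers n ≥ 1 such that R(c) has a factor of length 2n+1 with period n is infinite. -/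
/-- The coding g : 1 ↦ ε, 2 ↦ 0, 3 ↦ 1, 4 ↦ 00, 5 ↦ 11. -/
def g : ℕ → List Bool
  | 1 => []
  | 2 => [false]
  | 3 => [true]
  | 4 => [false, false]
  | 5 => [true, true]
  | _ => []

/-- The finite Restivo word R(c₀c₁⋯c_t) = g(c₀) μ(g(c₁)) ⋯ μ^t(g(c_t)). -/
def R (c : List ℕ) : List Bool :=
  ((List.range c.length).map (fun i => mu^[i] (g (c.getD i 0)))).flatten

/-- The Thue–Morse morphism on infinite words. -/
def muSeq (w : ℕ → Bool) : ℕ → Bool := fun n => xor (w (n / 2)) (n % 2 == 1)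

theorem muSeq_two_mul (w : ℕ → Bool) (k : ℕ) : muSeq w (2 * k) = w k := by
  simp [muSeq]

theorem muSeq_two_mul_add_one (w : ℕ → Bool) (k : ℕ) : muSeq w (2 * k + 1) = !w k := by
  have h : (2 * k + 1) / 2 = k := by omega
  simp [muSeq, h]

theorem appendSeq_nil (w : ℕ → Bool) : appendSeq [] w = w := by
  funext n; simp [appendSeq]

theorem appendSeq_singleton_zero (a : Bool) (w : ℕ → Bool) : appendSeq [a] w 0 = a := by
  simp [appendSeq]

theorem appendSeq_singleton_succ (a : Bool) (w : ℕ → Bool) (n : ℕ) :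
    appendSeq [a] w (n + 1) = w n := by
  simp [appendSeq]

theorem prefixSeq_iff {α : Type*} (u : List α) (w : ℕ → α) :
    PrefixSeq u w ↔ ∀ j < u.length, u[j]? = some (w j) := by
  unfold PrefixSeq
  refine forall_congr' fun j => forall_congr' fun h => ?_
  simp [List.getElem?_eq_getElem h]

theorem mu_cons (a : Bool) (u : List Bool) : mu (a :: u) = a :: (!a) :: mu u := by
  simp [mu]

theorem mu_flatten (l : List (List Bool)) : mu l.flatten = (l.map mu).flatten := by
  induction l with
  | nil => simp [mu]
  | cons a l ih => simp [mu_append, ih]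

theorem length_mu (u : List Bool) : (mu u).length = 2 * u.length := by
  induction u with
  | nil => simp [mu]
  | cons a u ih => simp [mu_cons, ih]; omega

theorem getElem?_mu_two_mul (u : List Bool) (k : ℕ) : (mu u)[2 * k]? = u[k]? := by
  induction u generalizing k with
  | nil => simp [mu]
  | cons a u ih =>
    cases k with
    | zero => simp [mu_cons]
    | succ k => simp [mu_cons, Nat.mul_add, ih]

theorem getElem?_mu_two_mul_add_one (u : List Bool) (k : ℕ) :
    (mu u)[2 * k + 1]? = u[k]?.map (!·) := by
  induction u generalizing k with
  | nil => simp [mu]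
  | cons a u ih =>
    cases k with
    | zero => simp [mu_cons]
    | succ k => simp [mu_cons, Nat.mul_add, ih]

theorem restivoJoin_succ' (x : ℕ → List Bool) (n : ℕ) :
    restivoJoin x (n + 1) = x 0 ++ mu (restivoJoin (fun i => x (i + 1)) n) := by
  simp only [restivoJoin, List.range_succ_eq_map, List.map_cons, List.flatten_cons,
    Function.iterate_zero, id_eq, mu_flatten, List.map_map]
  congr 3
  funext i
  simp [Function.iterate_succ_apply']

theorem length_restivoJoin_unbounded (x : ℕ → List Bool) (hx : ∀ N, ∃ i ≥ N, x i ≠ []) (m : ℕ) :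
    ∃ n, m < (restivoJoin x n).length := by
  have succ (n : ℕ) : restivoJoin x (n + 1) = restivoJoin x n ++ mu^[n] (x n) := by
    simp [restivoJoin, List.range_succ]
  have len (i : ℕ) (u : List Bool) : (mu^[i] u).length = 2 ^ i * u.length := by
    induction i with
    | zero => simp
    | succ i ih => rw [Function.iterate_succ_apply', length_mu, ih]; ring
  obtain ⟨i, hi, hne⟩ := hx m
  refine ⟨i + 1, ?_⟩
  have h1 : 1 ≤ (x i).length := List.length_pos_iff.2 hne
  have h2 := Nat.lt_two_pow_self (n := i)
  rw [succ, List.length_append, len]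
  nlinarith

/-- An infinite Restivo word is its first piece followed by the image under the Thue–Morse
morphism of the Restivo word of the shifted code. -/
theorem exists_desubstitution (x : ℕ → List Bool) (hx : ∀ N, ∃ i ≥ N, x i ≠ []) (w : ℕ → Bool)
    (hw : ∀ n, PrefixSeq (restivoJoin x n) w) :
    ∃ w', (∀ n, PrefixSeq (restivoJoin (fun i => x (i + 1)) n) w') ∧
      w = appendSeq (x 0) (muSeq w') := by
  have hx' : ∀ N, ∃ i ≥ N, x (i + 1) ≠ [] := fun N => by
    obtain ⟨i, hi, h⟩ := hx (N + 1)
    exact ⟨i - 1, by omega, by rwa [Nat.sub_add_cancel (by omega)]⟩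
  have tail (n j : ℕ) (hj : j < 2 * (restivoJoin (fun i => x (i + 1)) n).length) :
      (mu (restivoJoin (fun i => x (i + 1)) n))[j]? = some (w ((x 0).length + j)) := by
    have h := (prefixSeq_iff _ _).1 (hw (n + 1)) ((x 0).length + j)
    rw [restivoJoin_succ', List.length_append, length_mu] at h
    simpa [List.getElem?_append_right] using h (by omega)
  have hpre (n : ℕ) : ∀ k < (restivoJoin (fun i => x (i + 1)) n).length,
      (restivoJoin (fun i => x (i + 1)) n)[k]? = some (w ((x 0).length + 2 * k)) := fun k hk => by
    rw [← getElem?_mu_two_mul, tail n _ (by omega)]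
  refine ⟨fun k => w ((x 0).length + 2 * k), fun n => (prefixSeq_iff _ _).2 (hpre n), ?_⟩
  funext j
  unfold appendSeq
  split_ifs with hj
  · have h := (prefixSeq_iff _ _).1 (hw 1) j
    simp only [restivoJoin] at h
    simp [hj] at h
    simp [h]
  · obtain ⟨k, rfl⟩ := Nat.exists_eq_add_of_le (not_lt.1 hj)
    rw [Nat.add_sub_cancel_left]
    obtain ⟨m, rfl | rfl⟩ : ∃ m, k = 2 * m ∨ k = 2 * m + 1 := ⟨k / 2, by omega⟩
    · rw [muSeq_two_mul]
    · rw [muSeq_two_mul_add_one]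
      obtain ⟨n, hn⟩ := length_restivoJoin_unbounded _ hx' m
      have h := tail n (2 * m + 1) (by omega)
      rw [getElem?_mu_two_mul_add_one, hpre n m hn] at h
      simpa using h.symm

/-- Infinite Restivo words all of whose pieces are empty or the letter `0`, the latter only at
even places. -/
def IsEvenZeroRestivo (x : ℕ → List Bool) (w : ℕ → Bool) : Prop :=
  (∀ i, x i = [] ∨ x i = [false] ∧ Even i) ∧ (∀ N, ∃ i ≥ N, x i ≠ []) ∧
    ∀ n, PrefixSeq (restivoJoin x n) w

theorem IsEvenZeroRestivo.desubstitution {x : ℕ → List Bool} {w : ℕ → Bool}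
    (h : IsEvenZeroRestivo x w) :
    ∃ w', IsEvenZeroRestivo (fun i => x (i + 2)) w' ∧
      w = appendSeq (x 0) (muSeq (muSeq w')) := by
  obtain ⟨hx, hinf, hw⟩ := h
  have shift (d : ℕ) : ∀ N, ∃ i ≥ N, x (i + d) ≠ [] := fun N => by
    obtain ⟨i, hi, h⟩ := hinf (N + d)
    exact ⟨i - d, by omega, by rwa [Nat.sub_add_cancel (by omega)]⟩
  obtain ⟨w₁, hw₁, rfl⟩ := exists_desubstitution x hinf w hw
  obtain ⟨w₂, hw₂, rfl⟩ := exists_desubstitution _ (shift 1) w₁ hw₁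
  have h1 : x (0 + 1) = [] := by simpa using hx 1
  refine ⟨w₂, ⟨fun i => ?_, shift 2, hw₂⟩, by simp only [h1, appendSeq_nil]⟩
  simpa [Nat.even_add] using hx (i + 2)

theorem IsEvenZeroRestivo.induction {P : (ℕ → Bool) → Prop}
    (cons : ∀ x w, IsEvenZeroRestivo x w → P (appendSeq [false] (muSeq (muSeq w))))
    (map : ∀ x w, IsEvenZeroRestivo x w → P w → P (muSeq (muSeq w)))
    {x : ℕ → List Bool} {w : ℕ → Bool} (h : IsEvenZeroRestivo x w) : P w := by
  obtain ⟨k, -, hk⟩ := h.2.1 0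
  induction k using Nat.strong_induction_on generalizing x w with
  | _ k ih =>
    obtain ⟨w', hw', rfl⟩ := h.desubstitution
    rcases h.1 0 with h0 | ⟨h0, -⟩
    · rw [h0, appendSeq_nil]
      have hk0 : k ≠ 0 := fun e => hk (e ▸ h0)
      have hk1 : k ≠ 1 := fun e => hk (by subst e; simpa using h.1 1)
      exact map _ _ hw' (ih (k - 2) (by omega) hw' (by rwa [Nat.sub_add_cancel (by omega)]))
    · rw [h0]
      exact cons _ _ hw'

theorem IsEvenZeroRestivo.apply_zero {x : ℕ → List Bool} {w : ℕ → Bool}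
    (h : IsEvenZeroRestivo x w) : w 0 = false :=
  h.induction (P := fun w => w 0 = false) (fun _ _ _ => appendSeq_singleton_zero _ _)
    fun _ _ _ h => by simpa [muSeq] using h

/-- The factor of `w` of length `L + p` starting at `i` has period `p`. -/
def IsRun (w : ℕ → Bool) (p i L : ℕ) : Prop := ∀ j < L, w (i + j) = w (i + j + p)

theorem IsRun.muSeq {w : ℕ → Bool} {p i L : ℕ} (h : IsRun w p i L) :
    IsRun (muSeq w) (2 * p) (2 * i) (2 * L) := fun j hj => by
  have h1 : (2 * i + j) / 2 = i + j / 2 := by omega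
  have h2 : (2 * i + j + 2 * p) / 2 = i + j / 2 + p := by omega
  have h3 : (2 * i + j + 2 * p) % 2 = (2 * i + j) % 2 := by omega
  simp only [_root_.muSeq, h1, h2, h3, h (j / 2) (by omega)]

theorem IsRun.of_muSeq {w : ℕ → Bool} {p i L : ℕ} (h : IsRun (_root_.muSeq w) (2 * p) i L) :
    IsRun w p (i / 2) ((L + 1) / 2) := fun j hj => by
  have h1 := h (2 * j - i % 2) (by omega)
  have h2 : (i + (2 * j - i % 2)) / 2 = i / 2 + j := by omega
  have h3 : (i + (2 * j - i % 2) + 2 * p) / 2 = i / 2 + j + p := by omega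
  have h4 : (i + (2 * j - i % 2) + 2 * p) % 2 = (i + (2 * j - i % 2)) % 2 := by omega
  simpa only [_root_.muSeq, h2, h3, h4, Bool.xor_left_inj] using h1

/-- Images under the Thue–Morse morphism contain no overlap of odd period. -/
theorem not_isRun_muSeq_of_odd (w : ℕ → Bool) {p i L : ℕ} (hp : Odd p) (hL : p + 1 ≤ L) :
    ¬ IsRun (muSeq w) p i L := fun h => by
  have pair (n : ℕ) (hn : n % 2 = 0) : muSeq w (n + 1) = !muSeq w n := by
    obtain ⟨k, rfl⟩ : ∃ k, n = 2 * k := ⟨n / 2, by omega⟩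
    rw [muSeq_two_mul, muSeq_two_mul_add_one]
  have hp2 : p % 2 = 1 := Nat.odd_iff.1 hp
  have alt (j : ℕ) (hj : j < p) : muSeq w (i + j + 1) = !muSeq w (i + j) := by
    rcases Nat.mod_two_eq_zero_or_one (i + j) with e | e
    · exact pair _ e
    · have h1 := h j (by omega)
      have h2 := h (j + 1) (by omega)
      rw [h1, ← add_assoc] at *
      rw [h2, ← pair _ (by omega)]
      congr 1
      omega
  have par (j : ℕ) (hj : j ≤ p) : muSeq w (i + j) = xor (muSeq w i) (j % 2 == 1) := by
    induction j with
    | zero => simp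
    | succ j ih =>
      rw [← add_assoc, alt j (by omega), ih (by omega)]
      rcases Nat.mod_two_eq_zero_or_one j with e | e
      · have : (j + 1) % 2 = 1 := by omega
        simp [e, this]
      · have : (j + 1) % 2 = 0 := by omega
        simp [e, this]
  have h0 := h 0 (by omega)
  rw [add_zero, par p le_rfl, hp2] at h0
  simp at h0

theorem IsEvenZeroRestivo.not_isRun {x : ℕ → List Bool} {w : ℕ → Bool}
    (h : IsEvenZeroRestivo x w) {p i L : ℕ} (hp : 1 ≤ p) (hL : 4 * p ≤ 3 * L) :
    ¬ IsRun w p i L := by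
  induction p using Nat.strong_induction_on generalizing x w i L with
  | _ p ih =>
    intro hr
    obtain ⟨w', hw', rfl⟩ := h.desubstitution
    obtain ⟨i', M, hr', hM, hM'⟩ : ∃ i' M, IsRun (muSeq (muSeq w')) p i' M ∧ L ≤ M + 1 ∧
        (4 ≤ p ∨ M = L) := by
      rcases h.1 0 with h0 | ⟨h0, -⟩
      · rw [h0, appendSeq_nil] at hr
        exact ⟨i, L, hr, by omega, Or.inr rfl⟩
      · rw [h0] at hr
        cases i with
        | succ i =>
          refine ⟨i, L, fun j hj => ?_, by omega, Or.inr rfl⟩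
          have := hr j hj
          rwa [show i + 1 + j = i + j + 1 by omega, show i + j + 1 + p = i + j + p + 1 by omega,
            appendSeq_singleton_succ, appendSeq_singleton_succ] at this
        | zero =>
          refine ⟨0, L - 1, fun j hj => ?_, by omega, Or.inl ?_⟩
          · have := hr (j + 1) (by omega)
            rwa [show 0 + (j + 1) = 0 + j + 1 by omega,
              show 0 + j + 1 + p = 0 + j + p + 1 by omega,
              appendSeq_singleton_succ, appendSeq_singleton_succ] at this
          · by_contra hlt
            have e := hw'.apply_zero
            have r0 := hr 0 (by omega)
            have r1 := hr 1 (by omega)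
            have hcases : p = 1 ∨ p = 2 ∨ p = 3 := by omega
            rcases hcases with rfl | rfl | rfl <;>
              simp [appendSeq, muSeq, e] at r0 r1
    rcases Nat.even_or_odd' p with ⟨q, rfl | rfl⟩
    · rcases Nat.even_or_odd' q with ⟨r, rfl | rfl⟩
      · exact ih r (by omega) hw' (by omega) (by omega) hr'.of_muSeq.of_muSeq
      · exact not_isRun_muSeq_of_odd _ ⟨r, rfl⟩ (by omega) hr'.of_muSeq
    · exact not_isRun_muSeq_of_odd _ ⟨q, rfl⟩ (by omega) hr'

theorem IsEvenZeroRestivo.exists_prefix_square {x : ℕ → List Bool} {w : ℕ → Bool}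
    (h : IsEvenZeroRestivo x w) : ∃ q, IsRun w (q + 1) 0 (q + 1) ∧ w q = false := by
  refine h.induction (P := fun w => ∃ q, IsRun w (q + 1) 0 (q + 1) ∧ w q = false)
    (fun x w hw => ⟨0, fun j hj => ?_, appendSeq_singleton_zero _ _⟩) ?_
  · obtain rfl : j = 0 := by omega
    simp [appendSeq, _root_.muSeq, hw.apply_zero]
  · rintro x w - ⟨q, hr, hq⟩
    refine ⟨2 * (2 * q + 1) + 1, ?_, by
      rw [muSeq_two_mul_add_one, muSeq_two_mul_add_one, hq]; rfl⟩
    convert hr.muSeq.muSeq using 1 <;> ring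

theorem IsEvenZeroRestivo.exists_overlap {x : ℕ → List Bool} {w : ℕ → Bool}
    (h : IsEvenZeroRestivo x w) : ∃ p ≥ 1, ∃ i, IsRun w p i (p + 1) := by
  refine h.induction (P := fun w => ∃ p ≥ 1, ∃ i, IsRun w p i (p + 1)) (fun x w hw => ?_) ?_
  · obtain ⟨q, hr, hq⟩ := hw.exists_prefix_square
    refine ⟨2 * (2 * (q + 1)), by omega, 0, fun j hj => ?_⟩
    cases j with
    | zero =>
      rw [show 0 + 0 + 2 * (2 * (q + 1)) = 2 * (2 * q + 1) + 1 + 1 by ring,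
        appendSeq_singleton_succ, muSeq_two_mul_add_one, muSeq_two_mul_add_one, hq]
      rfl
    | succ j =>
      have := hr.muSeq.muSeq j (by omega)
      rw [← add_assoc, show 0 + j + 1 + 2 * (2 * (q + 1)) = j + 2 * (2 * (q + 1)) + 1 by ring,
        appendSeq_singleton_succ, appendSeq_singleton_succ]
      simpa using this
  · rintro x w - ⟨p, hp, i, hr⟩
    exact ⟨_, by omega, _, fun j hj => hr.muSeq.muSeq j (by omega)⟩

theorem IsEvenZeroRestivo.exists_overlap_gt {x : ℕ → List Bool} {w : ℕ → Bool}
    (h : IsEvenZeroRestivo x w) (N : ℕ) : ∃ p > N, ∃ i, IsRun w p i (p + 1) := by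
  induction N generalizing x w with
  | zero => exact h.exists_overlap
  | succ N ih =>
    obtain ⟨w', hw', rfl⟩ := h.desubstitution
    obtain ⟨p, hp, i, hr⟩ := ih hw'
    refine ⟨2 * (2 * p), by omega, (x 0).length + 2 * (2 * i), fun j hj => ?_⟩
    have := hr.muSeq.muSeq j (by omega)
    simpa [appendSeq, add_assoc] using this

theorem hasPeriod_leastPeriod {u : List Bool} (hu : u ≠ []) : HasPeriod u (leastPeriod u) :=
  Nat.sInf_mem (s := {p | HasPeriod u p})
    ⟨u.length, List.length_pos_iff.2 hu, le_rfl, fun i hi => by omega⟩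

theorem avoidsPowSeq_seven_thirds {w : ℕ → Bool}
    (h : ∀ p i L, 1 ≤ p → 4 * p ≤ 3 * L → ¬ IsRun w p i L) : AvoidsPowSeq (7 / 3) w := by
  rintro u hu ⟨i, hi⟩
  obtain ⟨h1, h2, h3⟩ := hasPeriod_leastPeriod hu
  unfold exponent
  have hpos : (0 : ℚ) < leastPeriod u := by exact_mod_cast h1
  rw [div_lt_iff₀ hpos]
  by_contra! hle
  have hle' : 7 * leastPeriod u ≤ 3 * u.length := by
    have : (7 : ℚ) * leastPeriod u ≤ 3 * u.length := by linarith
    exact_mod_cast this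
  refine h (leastPeriod u) i (u.length - leastPeriod u) h1 (by omega) fun j hj => ?_
  have e := h3 j (by omega)
  rw [List.getD_eq_getElem _ _ (by omega), List.getD_eq_getElem _ _ (by omega)] at e
  rw [add_assoc, ← hi j (by omega), ← hi (j + leastPeriod u) (by omega)]
  simpa using e

theorem IsRun.exists_factor {w : ℕ → Bool} {p i : ℕ} (hp : 1 ≤ p) (h : IsRun w p i (p + 1)) :
    ∃ u : List Bool, IsFactorSeq u w ∧ u.length = 2 * p + 1 ∧ HasPeriod u p := by
  refine ⟨(List.range (2 * p + 1)).map fun j => w (i + j), ⟨i, fun j hj => by simp⟩, by simp,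
    hp, by simp; omega, fun j hj => ?_⟩
  rw [List.length_map, List.length_range] at hj
  rw [List.getD_eq_getElem _ _ (by simp; omega), List.getD_eq_getElem _ _ (by simpa using hj)]
  simpa [add_assoc] using h j (by omega)

theorem code_eq_one_or_two (c : ℕ → ℕ) (b : ℕ → List ℕ)
    (hb : ∀ k, b k = [1, 2] ∨ b k = [1, 1, 1, 2])
    (hc : ∀ n : ℕ, PrefixSeq ([2, 1, 2] ++ ((List.range n).map b).flatten) c) (n : ℕ) :
    ∃ m ≥ n, ([2, 1, 2] ++ ((List.range n).map b).flatten).length = 2 * m + 1 ∧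
      c (2 * m) = 2 ∧ ∀ i < 2 * m + 1, c i = 1 ∨ c i = 2 ∧ Even i := by
  induction n with
  | zero =>
    have h := hc 0
    have h0 : 2 = c 0 := h 0 (by simp)
    have h1 : 1 = c 1 := h 1 (by simp)
    have h2 : 2 = c 2 := h 2 (by simp)
    refine ⟨1, by omega, by simp, h2.symm, fun i hi => ?_⟩
    interval_cases i
    · exact Or.inr ⟨h0.symm, by decide⟩
    · exact Or.inl h1.symm
    · exact Or.inr ⟨h2.symm, by decide⟩
  | succ n ih =>
    obtain ⟨m, hm, hlen, -, hi⟩ := ih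
    have hsucc : [2, 1, 2] ++ ((List.range (n + 1)).map b).flatten =
        ([2, 1, 2] ++ ((List.range n).map b).flatten) ++ b n := by
      simp [List.range_succ]
    have h := (prefixSeq_iff _ _).1 (hc (n + 1))
    rw [hsucc, List.length_append, hlen] at h
    rw [hsucc, List.length_append, hlen]
    have hnew (j : ℕ) (hj : j < (b n).length) : (b n)[j]? = some (c (2 * m + 1 + j)) := by
      rw [← h _ (by omega), List.getElem?_append_right (by omega), hlen]
      simp
    rcases hb n with e | e <;> rw [e] at hnew ⊢
    · have e0 : 1 = c (2 * m + 1) := by simpa using hnew 0 (by simp)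
      have e1 : 2 = c (2 * m + 2) := by simpa using hnew 1 (by simp)
      refine ⟨m + 1, by omega, by simp; omega, e1.symm, fun i hi' => ?_⟩
      obtain h | rfl | rfl : i < 2 * m + 1 ∨ i = 2 * m + 1 ∨ i = 2 * m + 2 := by omega
      · exact hi i h
      · exact Or.inl e0.symm
      · exact Or.inr ⟨e1.symm, by simp [parity_simps]⟩
    · have e0 : 1 = c (2 * m + 1) := by simpa using hnew 0 (by simp)
      have e1 : 1 = c (2 * m + 2) := by simpa using hnew 1 (by simp)
      have e2 : 1 = c (2 * m + 3) := by simpa using hnew 2 (by simp)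
      have e3 : 2 = c (2 * m + 4) := by simpa using hnew 3 (by simp)
      refine ⟨m + 2, by omega, by simp; omega, e3.symm, fun i hi' => ?_⟩
      obtain h | rfl | rfl | rfl | rfl : i < 2 * m + 1 ∨ i = 2 * m + 1 ∨ i = 2 * m + 2 ∨
        i = 2 * m + 3 ∨ i = 2 * m + 4 := by omega
      · exact hi i h
      · exact Or.inl e0.symm
      · exact Or.inl e1.symm
      · exact Or.inl e2.symm
      · exact Or.inr ⟨e3.symm, ⟨m + 2, by ring⟩⟩

/-- For every infinite code word c ∈ 212{12,1112}^ω, the infinite Restivo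
word R(c) avoids 7/3-powers and contains overlaps of infinitely many
different periods. -/
theorem code_overlap_periods_infinite (c : ℕ → ℕ)
    (hc : ∃ b : ℕ → List ℕ, (∀ k, b k = [1, 2] ∨ b k = [1, 1, 1, 2]) ∧
      ∀ n : ℕ, PrefixSeq ([2, 1, 2] ++ ((List.range n).map b).flatten) c)
    (w : ℕ → Bool)
    (hw : ∀ n : ℕ,
      PrefixSeq (((List.range n).map (fun i => mu^[i] (g (c i)))).flatten) w) :
    AvoidsPowSeq (7/3) w ∧
    {n : ℕ | 1 ≤ n ∧ ∃ u : List Bool, IsFactorSeq u w ∧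
        u.length = 2 * n + 1 ∧ HasPeriod u n}.Infinite := by
  obtain ⟨b, hb, hc⟩ := hc
  have hcode := code_eq_one_or_two c b hb hc
  have key : IsEvenZeroRestivo (fun i => g (c i)) w := by
    refine ⟨fun i => ?_, fun N => ?_, hw⟩
    · obtain ⟨m, hm, -, -, h⟩ := hcode i
      rcases h i (by omega) with e | ⟨e, hi⟩
      · exact Or.inl (by simp [e, g])
      · exact Or.inr ⟨by simp [e, g], hi⟩
    · obtain ⟨m, hm, -, e, -⟩ := hcode N
      exact ⟨2 * m, by omega, by simp [e, g]⟩
  refine ⟨avoidsPowSeq_seven_thirds fun p i L hp hL => key.not_isRun hp hL,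
    Set.infinite_of_forall_exists_gt fun N => ?_⟩
  obtain ⟨p, hp, i, hr⟩ := key.exists_overlap_gt N
  exact ⟨p, ⟨by omega, hr.exists_factor (by omega)⟩, hp⟩
end

section
/- The function E is strictly increasing: E(n) < E(n+1) for every integer n ≥ 1. -/
theorem thueMorse_two_mul (n : ℕ) : thueMorse (2 * n) = thueMorse n := by
  rcases Nat.eq_zero_or_pos n with rfl | hn
  · rfl
  · simp [thueMorse, Nat.digits_def' (b := 2) (n := 2 * n) (by norm_num) (by omega)]

theorem thueMorse_two_mul_add_one (n : ℕ) : thueMorse (2 * n + 1) = !thueMorse n := by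
  have hdiv : (2 * n + 1) / 2 = n := by omega
  have hmod : (2 * n + 1) % 2 = 1 := by omega
  simp only [thueMorse, Nat.digits_def' (b := 2) (n := 2 * n + 1) (by norm_num) (by omega),
    hdiv, hmod, List.count_cons_self]
  rcases Nat.mod_two_eq_zero_or_one ((Nat.digits 2 n).count 1) with h | h <;>
    simp [Nat.add_mod, h]

theorem thueMorse_not_cube (m : ℕ) (h₁ : thueMorse m = thueMorse (m + 1))
    (h₂ : thueMorse (m + 1) = thueMorse (m + 2)) : False := by
  obtain ⟨k, rfl | rfl⟩ := Nat.even_or_odd' m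
  · rw [thueMorse_two_mul, thueMorse_two_mul_add_one] at h₁
    simp at h₁
  · rw [show 2 * k + 1 + 1 = 2 * (k + 1) by ring, show 2 * k + 1 + 2 = 2 * (k + 1) + 1 by ring,
      thueMorse_two_mul, thueMorse_two_mul_add_one] at h₂
    simp at h₂

theorem thueMorse_eq_succ_of_shift {m k : ℕ} (h₀ : thueMorse (2 * m) = thueMorse (2 * k + 1))
    (h₁ : thueMorse (2 * m + 1) = thueMorse (2 * (k + 1))) :
    thueMorse k = thueMorse (k + 1) := by
  rw [thueMorse_two_mul, thueMorse_two_mul_add_one] at h₀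
  rw [thueMorse_two_mul, thueMorse_two_mul_add_one] at h₁
  simpa [h₀] using h₁

/-- No factor of the Thue–Morse word of length `2 * p + 1` has period `p`. -/
theorem thueMorse_not_overlap (p : ℕ) (hp : 1 ≤ p) (i : ℕ)
    (h : ∀ j ≤ p, thueMorse (i + j) = thueMorse (i + j + p)) : False := by
  induction p using Nat.strong_induction_on generalizing i with
  | _ p ih =>
  obtain ⟨q, rfl | rfl⟩ := Nat.even_or_odd' p
  · obtain ⟨m, rfl | rfl⟩ := Nat.even_or_odd' i
    · refine ih q (by omega) (by omega) m fun j hj => ?_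
      have := h (2 * j) (by omega)
      rwa [show 2 * m + 2 * j + 2 * q = 2 * (m + j + q) by ring,
        show 2 * m + 2 * j = 2 * (m + j) by ring, thueMorse_two_mul, thueMorse_two_mul] at this
    · refine ih q (by omega) (by omega) m fun j hj => ?_
      have := h (2 * j) (by omega)
      rw [show 2 * m + 1 + 2 * j + 2 * q = 2 * (m + j + q) + 1 by ring,
        show 2 * m + 1 + 2 * j = 2 * (m + j) + 1 by ring, thueMorse_two_mul_add_one,
        thueMorse_two_mul_add_one] at this
      simpa using this
  · rcases Nat.eq_zero_or_pos q with rfl | hq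
    · exact thueMorse_not_cube i (h 0 (by omega)) (h 1 (by omega))
    · have h0 := h 0 (by omega)
      have h1 := h 1 (by omega)
      have h2 := h 2 (by omega)
      have h3 := h 3 (by omega)
      obtain ⟨m, rfl | rfl⟩ := Nat.even_or_odd' i
      · refine thueMorse_not_cube (m + q) (thueMorse_eq_succ_of_shift (m := m) ?_ ?_)
          (thueMorse_eq_succ_of_shift (m := m + 1) ?_ ?_)
        · convert h0 using 2 <;> omega
        · convert h1 using 2 <;> omega
        · convert h2 using 2 <;> omega
        · convert h3 using 2 <;> omega
      · refine thueMorse_not_cube m (thueMorse_eq_succ_of_shift (m := m + q + 1) ?_ ?_)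
          (thueMorse_eq_succ_of_shift (m := m + q + 2) ?_ ?_)
        · convert h0.symm using 2 <;> omega
        · convert h1.symm using 2 <;> omega
        · convert h2.symm using 2 <;> omega
        · convert h3.symm using 2 <;> omega

theorem overlapFreeSeq_thueMorse_shift (s : ℕ) : OverlapFreeSeq fun j => thueMorse (s + j) := by
  rintro u ⟨i, hi⟩ ⟨a, x, rfl⟩
  refine thueMorse_not_overlap (x.length + 1) (by omega) (s + i) fun j hj => ?_
  have h₁ := hi j (by simp; omega)
  have h₂ := hi (j + (x.length + 1)) (by simp; omega)
  dsimp only at h₁ h₂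
  rw [add_assoc s i j, ← h₁, show s + (i + j) + (x.length + 1) = s + (i + (j + (x.length + 1))) by
    ring, ← h₂]
  simp only [List.get_eq_getElem]
  grind

theorem thueMorse_two_pow_mul (k n : ℕ) : thueMorse (2 ^ k * n) = thueMorse n := by
  induction k with
  | zero => simp
  | succ k ih => rw [pow_succ', mul_assoc, thueMorse_two_mul, ih]

theorem thueMorse_two_pow_mul_five_add (k b : ℕ) (hb : b < 2 ^ k) :
    thueMorse (2 ^ k * 5 + b) = thueMorse b := by
  induction k generalizing b with
  | zero =>
    obtain rfl : b = 0 := by simpa using hb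
    simp [thueMorse]
  | succ k ih =>
    rw [pow_succ'] at hb ⊢
    obtain ⟨c, rfl | rfl⟩ := Nat.even_or_odd' b
    · rw [mul_assoc, ← mul_add, thueMorse_two_mul, thueMorse_two_mul, ih c (by omega)]
    · rw [mul_assoc, ← add_assoc, ← mul_add, thueMorse_two_mul_add_one,
        thueMorse_two_mul_add_one, ih c (by omega)]

/-- The words of length `n` that are prefixes of infinite overlap-free words. -/
def extendableWords (n : ℕ) : Set (List Bool) :=
  {x | x.length = n ∧ ∃ y : ℕ → Bool, OverlapFreeSeq (appendSeq x y)}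

theorem finite_extendableWords (n : ℕ) : (extendableWords n).Finite :=
  (List.finite_length_eq Bool n).subset fun _ hx => hx.1

theorem appendSeq_ofFn (n : ℕ) (w : ℕ → Bool) :
    appendSeq (List.ofFn fun i : Fin n => w i) (fun j => w (n + j)) = w := by
  funext j
  by_cases h : j < n
  · simp [appendSeq, h]
  · simp [appendSeq, h, Nat.add_sub_cancel' (Nat.le_of_not_lt h)]

theorem ofFn_mem_extendableWords {w : ℕ → Bool} (hw : OverlapFreeSeq w) (n : ℕ) :
    (List.ofFn fun i : Fin n => w i) ∈ extendableWords n :=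
  ⟨by simp, fun j => w (n + j), by rwa [appendSeq_ofFn]⟩

theorem ofFn_appendSeq (x : List Bool) (y : ℕ → Bool) :
    (List.ofFn fun i : Fin x.length => appendSeq x y i) = x := by
  apply List.ext_getElem <;> simp +contextual [appendSeq]

theorem take_ofFn_succ (n : ℕ) (w : ℕ → Bool) :
    (List.ofFn fun i : Fin (n + 1) => w i).take n = List.ofFn fun i : Fin n => w i := by
  apply List.ext_getElem <;> simp [-List.ofFn_succ]

theorem extendableWords_subset_image_take (n : ℕ) :
    extendableWords n ⊆ List.take n '' extendableWords (n + 1) := by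
  rintro x ⟨rfl, y, hy⟩
  exact ⟨_, ofFn_mem_extendableWords hy _, by rw [take_ofFn_succ, ofFn_appendSeq]⟩

theorem exists_overlapFreeSeq_pair (n : ℕ) : ∃ v w : ℕ → Bool, OverlapFreeSeq v ∧
    OverlapFreeSeq w ∧ (∀ i < n, v i = w i) ∧ v n ≠ w n := by
  have hn : n < 2 ^ n := Nat.lt_two_pow_self
  refine ⟨fun j => thueMorse (2 ^ n - n + j), fun j => thueMorse (2 ^ n * 5 + (2 ^ n - n) + j),
    overlapFreeSeq_thueMorse_shift _, overlapFreeSeq_thueMorse_shift _, fun i hi => ?_, ?_⟩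
  · dsimp only
    rw [add_assoc, thueMorse_two_pow_mul_five_add _ _ (by omega)]
  · dsimp only
    rw [show 2 ^ n - n + n = 2 ^ n * 1 by omega,
      show 2 ^ n * 5 + (2 ^ n - n) + n = 2 ^ n * 6 by omega, thueMorse_two_pow_mul,
      thueMorse_two_pow_mul]
    simp [thueMorse]

theorem not_injOn_take_extendableWords (n : ℕ) :
    ¬ Set.InjOn (List.take n) (extendableWords (n + 1)) := by
  intro h
  obtain ⟨v, w, hv, hw, hvw, hne⟩ := exists_overlapFreeSeq_pair n
  have heq := h (ofFn_mem_extendableWords hv _) (ofFn_mem_extendableWords hw _) (by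
    rw [take_ofFn_succ, take_ofFn_succ]
    exact congrArg List.ofFn (funext fun i => hvw i i.2))
  exact hne (congrFun (List.ofFn_injective heq) (Fin.last n))

/-- E is strictly increasing: E(n) < E(n+1) for all n ≥ 1. -/
theorem E_strictMono (n : ℕ) (hn : 1 ≤ n) : E n < E (n + 1) := by
  change (extendableWords n).ncard < (extendableWords (n + 1)).ncard
  have hfin := finite_extendableWords (n + 1)
  calc (extendableWords n).ncard
      ≤ (List.take n '' extendableWords (n + 1)).ncard :=
        Set.ncard_le_ncard (extendableWords_subset_image_take n) (hfin.image _)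
    _ < (extendableWords (n + 1)).ncard :=
        lt_of_le_of_ne (Set.ncard_image_le hfin) fun h =>
          not_injOn_take_extendableWords n (Set.injOn_of_ncard_image_eq h hfin)
end
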